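/- Let 0<q<1 and α ∈ ℝ, and for each nonnegative integer n let m_n = ∫₀^∞ xⁿ · x^α / ((−x;q)_∞ · (−q/x;q)_∞) dx be the n-th moment of Askey's weight. Then all m_n are finite and positive, and m_n / m_0 = q^{−n(α+1) − n(n−1)/2}. -/

import Mathlib

open MeasureTheory Set

/-- The q-Pochhammer infinite product `(x;q)_∞ = ∏_{k=0}^∞ (1 - x qᵏ)`. -/
noncomputable def qPoch (x q : ℝ) : ℝ := ∏' k : ℕ, (1 - x * q ^ k)

open Filter Topology in
theorem qPoch_tendsto {q : ℝ} (hq0 : 0 < q) (hq1 : q < 1) (x : ℝ) :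
    Tendsto (fun N : ℕ => ∏ k ∈ Finset.range N, (1 - x * q ^ k)) atTop (𝓝 (qPoch x q)) := by
  have hs : Summable fun k : ℕ => -(x * q ^ k) :=
    ((summable_geometric_of_lt_one hq0.le hq1).mul_left x).neg
  have h : Multipliable fun k : ℕ => 1 - x * q ^ k := by
    simpa [sub_eq_add_neg] using Real.multipliable_one_add_of_summable hs
  exact h.hasProd.tendsto_prod_nat

theorem qPoch_measurable {q : ℝ} (hq0 : 0 < q) (hq1 : q < 1) :
    Measurable fun x : ℝ => qPoch x q :=
  measurable_of_tendsto_metrizable (f := fun N x => ∏ k ∈ Finset.range N, (1 - x * q ^ k))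
    (fun N => by fun_prop) (tendsto_pi_nhds.2 (qPoch_tendsto hq0 hq1))

theorem qPoch_eq_mul {q : ℝ} (hq0 : 0 < q) (hq1 : q < 1) (x : ℝ) :
    qPoch x q = (1 - x) * qPoch (q * x) q := by
  have h1 := (qPoch_tendsto hq0 hq1 x).comp (Filter.tendsto_add_atTop_nat 1)
  have h2 := (qPoch_tendsto hq0 hq1 (q * x)).const_mul (1 - x)
  refine tendsto_nhds_unique h1 (h2.congr fun N => ?_)
  simp only [Function.comp, Finset.prod_range_succ', pow_zero, mul_one]
  rw [mul_comm]
  congr 1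
  exact Finset.prod_congr rfl fun k _ => by ring

theorem mul_pow_le_qPoch_neg {q : ℝ} (hq0 : 0 < q) (hq1 : q < 1) {y : ℝ} (hy : 0 ≤ y) (N : ℕ) :
    (∏ k ∈ Finset.range N, q ^ k) * y ^ N ≤ qPoch (-y) q := by
  have hmono : Monotone fun N : ℕ => ∏ k ∈ Finset.range N, (1 - -y * q ^ k) := by
    refine monotone_nat_of_le_succ fun n => ?_
    rw [Finset.prod_range_succ]
    refine le_mul_of_one_le_right (Finset.prod_nonneg fun k _ => ?_) ?_
    · have : 0 ≤ y * q ^ k := by positivity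
      linarith
    · have : 0 ≤ y * q ^ n := by positivity
      linarith
  refine le_trans ?_ (hmono.ge_of_tendsto (qPoch_tendsto hq0 hq1 (-y)) N)
  rw [← Finset.card_range N, ← Finset.prod_const, Finset.card_range, ← Finset.prod_mul_distrib]
  refine Finset.prod_le_prod (fun k _ => by positivity) fun k _ => ?_
  linarith [mul_comm y (q ^ k)]

theorem one_le_qPoch_neg {q : ℝ} (hq0 : 0 < q) (hq1 : q < 1) {y : ℝ} (hy : 0 ≤ y) :
    1 ≤ qPoch (-y) q := by
  simpa using mul_pow_le_qPoch_neg hq0 hq1 hy 0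

/-- The functional equation `w(q x) = q^α x w(x)` of Askey's weight. -/
theorem askey_weight_comp_mul {q : ℝ} (α : ℝ) (hq0 : 0 < q) (hq1 : q < 1) {x : ℝ} (hx : 0 < x) :
    (q * x) ^ α / (qPoch (-(q * x)) q * qPoch (-(q / (q * x))) q) =
      q ^ α * (x * (x ^ α / (qPoch (-x) q * qPoch (-(q / x)) q))) := by
  have h1 := qPoch_eq_mul hq0 hq1 (-x)
  have h2 := qPoch_eq_mul hq0 hq1 (-(q / (q * x)))
  have e1 : q * -x = -(q * x) := by ring
  have e2 : q * -(q / (q * x)) = -(q / x) := by field_simp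
  rw [e1] at h1
  rw [e2] at h2
  have p1 := one_le_qPoch_neg hq0 hq1 (mul_pos hq0 hx).le
  have p2 := one_le_qPoch_neg hq0 hq1 (div_pos hq0 hx).le
  have h3 : 1 - -(q / (q * x)) = (1 + x) / x := by field_simp; ring
  rw [h1, h2, h3, Real.mul_rpow hq0.le hx.le, sub_neg_eq_add]
  have : qPoch (-(q * x)) q ≠ 0 := by positivity
  have : qPoch (-(q / x)) q ≠ 0 := by positivity
  have : 1 + x ≠ 0 := by positivity
  field_simp

theorem askey_weight_pos {q : ℝ} (α : ℝ) (hq0 : 0 < q) (hq1 : q < 1) (n : ℕ) {x : ℝ}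
    (hx : 0 < x) : 0 < x ^ n * (x ^ α / (qPoch (-x) q * qPoch (-(q / x)) q)) := by
  have p1 := one_le_qPoch_neg hq0 hq1 hx.le
  have p2 := one_le_qPoch_neg hq0 hq1 (div_pos hq0 hx).le
  positivity

theorem integrableOn_askey_weight {q : ℝ} (α : ℝ) (hq0 : 0 < q) (hq1 : q < 1) (n : ℕ) :
    IntegrableOn (fun x : ℝ => x ^ n * (x ^ α / (qPoch (-x) q * qPoch (-(q / x)) q)))
      (Ioi (0 : ℝ)) := by
  have hmeas : Measurable
      fun x : ℝ => x ^ n * (x ^ α / (qPoch (-x) q * qPoch (-(q / x)) q)) := by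
    have hP := qPoch_measurable hq0 hq1
    have h1 : Measurable fun x : ℝ => qPoch (-x) q := hP.comp measurable_neg
    have h2 : Measurable fun x : ℝ => qPoch (-(q / x)) q :=
      hP.comp (measurable_const.div measurable_id).neg
    fun_prop
  obtain ⟨N, hN⟩ := exists_nat_gt (|n + α| + 1)
  have hN1 := neg_abs_le (n + α)
  have hN2 := le_abs_self (n + α)
  set c : ℝ := ∏ k ∈ Finset.range N, q ^ k
  have hc0 : 0 < c := Finset.prod_pos fun k _ => by positivity
  rw [← Ioc_union_Ioi_eq_Ioi (zero_le_one' ℝ)]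
  refine IntegrableOn.union ?_ ?_
  · refine Measure.integrableOn_of_bounded (M := (c * q ^ N)⁻¹) (by simp)
      hmeas.aestronglyMeasurable ?_
    filter_upwards [ae_restrict_mem measurableSet_Ioc] with x hx
    have hx0 := hx.1
    rw [Real.norm_of_nonneg (askey_weight_pos α hq0 hq1 n hx0).le]
    have p1 := one_le_qPoch_neg hq0 hq1 hx0.le
    have p2 := mul_pow_le_qPoch_neg hq0 hq1 (div_pos hq0 hx0).le N
    have hb : c * (q / x) ^ N ≤ qPoch (-x) q * qPoch (-(q / x)) q :=
      p2.trans (le_mul_of_one_le_left (le_trans (by positivity) p2) p1)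
    calc x ^ n * (x ^ α / (qPoch (-x) q * qPoch (-(q / x)) q))
        ≤ x ^ n * (x ^ α / (c * (q / x) ^ N)) := by gcongr
      _ = (c * q ^ N)⁻¹ * x ^ (n + α + N) := by
        rw [Real.rpow_add hx0, Real.rpow_add hx0, Real.rpow_natCast, Real.rpow_natCast,
          div_pow]
        field_simp
      _ ≤ (c * q ^ N)⁻¹ :=
        mul_le_of_le_one_right (by positivity)
          (Real.rpow_le_one hx0.le hx.2 (by linarith))
  · have hg : IntegrableOn (fun x : ℝ => c⁻¹ * x ^ (n + α - N)) (Ioi (1 : ℝ)) :=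
      (integrableOn_Ioi_rpow_of_lt (by linarith) one_pos).const_mul _
    refine Integrable.mono' hg hmeas.aestronglyMeasurable ?_
    filter_upwards [ae_restrict_mem measurableSet_Ioi] with x hx
    have hx0 : 0 < x := one_pos.trans hx
    rw [Real.norm_of_nonneg (askey_weight_pos α hq0 hq1 n hx0).le]
    have p1 := one_le_qPoch_neg hq0 hq1 (div_pos hq0 hx0).le
    have p2 := mul_pow_le_qPoch_neg hq0 hq1 hx0.le N
    have hb : c * x ^ N ≤ qPoch (-x) q * qPoch (-(q / x)) q :=
      p2.trans (le_mul_of_one_le_right (le_trans (by positivity) p2) p1)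
    calc x ^ n * (x ^ α / (qPoch (-x) q * qPoch (-(q / x)) q))
        ≤ x ^ n * (x ^ α / (c * x ^ N)) := by gcongr
      _ = c⁻¹ * x ^ (n + α - N) := by
        rw [Real.rpow_sub hx0, Real.rpow_add hx0, Real.rpow_natCast, Real.rpow_natCast]
        field_simp

/-- The moments of Askey's weight `x^α / ((-x;q)_∞ (-q/x;q)_∞)` are finite and positive,
and satisfy `m_n/m_0 = q^{-n(α+1)-n(n-1)/2}`. -/
theorem askey_weight_moments
    (q α : ℝ) (hq0 : 0 < q) (hq1 : q < 1)
    (m : ℕ → ℝ)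
    (hm : ∀ n : ℕ, m n = ∫ x in Ioi (0 : ℝ),
      x ^ n * (x ^ α / (qPoch (-x) q * qPoch (-(q / x)) q))) :
    (∀ n : ℕ, IntegrableOn
      (fun x : ℝ => x ^ n * (x ^ α / (qPoch (-x) q * qPoch (-(q / x)) q)))
      (Ioi (0 : ℝ))) ∧
    (∀ n : ℕ, 0 < m n) ∧
    (∀ n : ℕ, m n / m 0 = q ^ (-(n : ℝ) * (α + 1) - (n : ℝ) * ((n : ℝ) - 1) / 2)) := by
  have hint := integrableOn_askey_weight α hq0 hq1
  have hpos : ∀ n, 0 < m n := fun n => by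
    rw [hm n, setIntegral_pos_iff_support_of_nonneg_ae _ (hint n)]
    · have : Ioi (0 : ℝ) ⊆ Function.support
          (fun x : ℝ => x ^ n * (x ^ α / (qPoch (-x) q * qPoch (-(q / x)) q))) :=
        fun x hx => (askey_weight_pos α hq0 hq1 n hx).ne'
      rw [inter_eq_right.2 this]
      simp
    · filter_upwards [ae_restrict_mem measurableSet_Ioi] with x hx
      exact (askey_weight_pos α hq0 hq1 n hx).le
  have hrec : ∀ n, m (n + 1) = q ^ (-(α + 1) - n) * m n := fun n => by
    have h := integral_comp_mul_left_Ioi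
      (fun x : ℝ => x ^ n * (x ^ α / (qPoch (-x) q * qPoch (-(q / x)) q))) 0 hq0
    rw [mul_zero, ← hm n, smul_eq_mul] at h
    have h' : q ^ n * q ^ α * m (n + 1) = q⁻¹ * m n := by
      rw [← h, hm (n + 1), ← integral_const_mul]
      refine setIntegral_congr_fun measurableSet_Ioi fun x hx => ?_
      rw [askey_weight_comp_mul α hq0 hq1 hx]
      ring
    have e : q ^ (-(α + 1) - n) = q⁻¹ * (q ^ n * q ^ α)⁻¹ := by
      rw [Real.rpow_sub hq0, Real.rpow_neg hq0.le, Real.rpow_add hq0, Real.rpow_natCast,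
        Real.rpow_one]
      field_simp
    have : 0 < q ^ α := Real.rpow_pos_of_pos hq0 α
    rw [e]
    field_simp at h' ⊢
    linarith
  refine ⟨hint, hpos, fun n => ?_⟩
  induction n with
  | zero => simp [(hpos 0).ne']
  | succ n ih =>
    rw [hrec, mul_div_assoc, ih, ← Real.rpow_add hq0]
    congr 1
    push_cast
    ring
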